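/- Let S be a monoid with zero (0 ≠ 1). Then S is left perfect if and only if S is left 0-perfect; that is, every nonempty S-act admits a projective cover in the category of S-acts if and only if every pointed S-act admits a projective cover in the category of pointed S-acts. -/

import Mathlib

universe u

/-- A subact of an `S`-act: a nonempty subset closed under the action. -/
def IsSubact (S : Type u) [Monoid S] {A : Type u} [MulAction S A]
    (B : Set A) : Prop :=
  B.Nonempty ∧ ∀ (s : S) ⦃a : A⦄, a ∈ B → s • a ∈ B

/-- A subact of a pointed `S`-act: contains `0` and is closed under the
action. -/
def IsPSubact (S : Type u) [MonoidWithZero S] {A : Type u} [Zero A]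
    [MulActionWithZero S A] (B : Set A) : Prop :=
  (0 : A) ∈ B ∧ ∀ (s : S) ⦃a : A⦄, a ∈ B → s • a ∈ B

/-- `P` is projective in the category of `S`-acts. -/
def ActProjective (S : Type u) [Monoid S] (P : Type u) [MulAction S P] : Prop :=
  ∀ (A B : Type u) [MulAction S A] [MulAction S B] (π : A → B) (f : P → B),
    Function.Surjective π → (∀ (s : S) (a : A), π (s • a) = s • π a) →
    (∀ (s : S) (x : P), f (s • x) = s • f x) →
    ∃ h : P → A, (∀ (s : S) (x : P), h (s • x) = s • h x) ∧ π ∘ h = f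

/-- `P` is projective in the category of pointed `S`-acts. -/
def PActProjective (S : Type u) [MonoidWithZero S] (P : Type u) [Zero P]
    [MulActionWithZero S P] : Prop :=
  ∀ (B C : Type u) [Zero B] [Zero C] [MulActionWithZero S B]
    [MulActionWithZero S C] (π : B → C) (f : P → C),
    Function.Surjective π → (∀ (s : S) (b : B), π (s • b) = s • π b) →
    π 0 = 0 →
    (∀ (s : S) (x : P), f (s • x) = s • f x) → f 0 = 0 →
    ∃ h : P → B,
      (∀ (s : S) (x : P), h (s • x) = s • h x) ∧ h 0 = 0 ∧ π ∘ h = f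

/-- `f : P → A` is a projective cover of the `S`-act `A`: a surjective
equivariant map from a projective act which is not surjective when restricted
to any proper subact of `P`. -/
def IsProjCover (S : Type u) [Monoid S] (P : Type u) [MulAction S P]
    (A : Type u) [MulAction S A] (f : P → A) : Prop :=
  Function.Surjective f ∧ (∀ (s : S) (x : P), f (s • x) = s • f x) ∧
    ActProjective S P ∧
    ∀ B : Set P, IsSubact S B → B ≠ Set.univ → f '' B ≠ Set.univ

/-- `f : P → A` is a projective cover of the pointed `S`-act `A` in the
category of pointed `S`-acts. -/
def IsPProjCover (S : Type u) [MonoidWithZero S] (P : Type u) [Zero P]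
    [MulActionWithZero S P] (A : Type u) [Zero A] [MulActionWithZero S A]
    (f : P → A) : Prop :=
  Function.Surjective f ∧ f 0 = 0 ∧
    (∀ (s : S) (x : P), f (s • x) = s • f x) ∧ PActProjective S P ∧
    ∀ B : Set P, IsPSubact S B → B ≠ Set.univ → f '' B ≠ Set.univ

/-- `S` is left perfect: every nonempty `S`-act admits a projective cover in
the category of `S`-acts. -/
def LeftPerfect (S : Type u) [Monoid S] : Prop :=
  ∀ (A : Type u) (instA : MulAction S A), Nonempty A →
    ∃ (P : Type u) (instP : MulAction S P) (f : P → A),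
      @IsProjCover S _ P instP A instA f

/-- `S` is left 0-perfect: every pointed `S`-act admits a projective cover in
the category of pointed `S`-acts. -/
def Left0Perfect (S : Type u) [MonoidWithZero S] : Prop :=
  ∀ (A : Type u) (zA : Zero A) (instA : MulActionWithZero S A),
    ∃ (P : Type u) (zP : Zero P) (instP : MulActionWithZero S P) (f : P → A),
      @IsPProjCover S _ P zP instP A zA instA f

/-- An `S`-act has a *tight generating set* if it is generated by an irredundant set `I`, each
element `i` of which is fixed by an idempotent `e i` such that every `t` fixing `i` satisfies
`e i ∈ S * t * e i`. -/
def HasTightGenerators (S : Type u) [Monoid S] (A : Type u) [MulAction S A] : Prop :=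
  ∃ (I : Set A) (e : A → S),
    (∀ a, ∃ i ∈ I, ∃ s : S, s • i = a) ∧
    (∀ i ∈ I, ∀ j ∈ I, ∀ s : S, s • j = i → i = j) ∧
    ∀ i ∈ I, e i * e i = e i ∧ e i • i = i ∧ ∀ t : S, t • i = i → ∃ s, s * t * e i = e i

/-- The coproduct of the acts `S * e i`, for `i ∈ I`. -/
def IdempotentCoproduct {S A : Type u} [Monoid S] (I : Set A) (e : A → S) : Type u :=
  {x : S × A // x.2 ∈ I ∧ x.1 * e x.2 = x.1}

instance {S A : Type u} [Monoid S] (I : Set A) (e : A → S) :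
    MulAction S (IdempotentCoproduct I e) where
  smul s x := ⟨(s * x.1.1, x.1.2), x.2.1, by rw [mul_assoc, x.2.2]⟩
  one_smul x := Subtype.ext (Prod.ext (one_mul _) rfl)
  mul_smul s t x := Subtype.ext (Prod.ext (mul_assoc s t _) rfl)

theorem HasTightGenerators.exists_isProjCover {S : Type u} [Monoid S] {A : Type u}
    [MulAction S A] (hA : HasTightGenerators S A) :
    ∃ (P : Type u) (_ : MulAction S P) (f : P → A), IsProjCover S P A f := by
  obtain ⟨I, e, hgen, hirr, he⟩ := hA
  have smul_gen (x : IdempotentCoproduct I e) :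
      x.1.1 • (show IdempotentCoproduct I e from ⟨(e x.1.2, x.1.2), x.2.1, (he _ x.2.1).1⟩) = x :=
    Subtype.ext (Prod.ext x.2.2 rfl)
  refine ⟨IdempotentCoproduct I e, inferInstance, fun x => x.1.1 • x.1.2, ?_,
    fun s x => mul_smul _ _ _, ?_, ?_⟩
  · intro a
    obtain ⟨i, hi, s, rfl⟩ := hgen a
    refine ⟨⟨(s * e i, i), hi, by simp only [mul_assoc, (he i hi).1]⟩, ?_⟩
    simp only [mul_smul, (he i hi).2.1]
  · intro X Y _ _ π g hπ hπs hgs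
    choose σ hσ using hπ
    refine ⟨fun x => x.1.1 • σ (g ⟨(e x.1.2, x.1.2), x.2.1, (he _ x.2.1).1⟩),
      fun s x => mul_smul _ _ _, funext fun x => ?_⟩
    change π (x.1.1 • σ (g _)) = g x
    rw [hπs, hσ]
    exact (hgs _ _).symm.trans (congrArg g (smul_gen x))
  · intro B hB hne himg
    refine hne (Set.eq_univ_of_forall fun x => ?_)
    obtain ⟨b, hb, hbx⟩ : x.1.2 ∈ (fun x : IdempotentCoproduct I e => x.1.1 • x.1.2) '' B :=
      himg ▸ Set.mem_univ _
    have hij : x.1.2 = b.1.2 := hirr _ x.2.1 _ b.2.1 _ hbx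
    obtain ⟨s, hs⟩ := (he _ x.2.1).2.2 b.1.1 (by rw [hij] at hbx ⊢; exact hbx)
    rw [← smul_gen x]
    refine hB.2 _ ?_
    convert hB.2 s hb using 1
    refine Subtype.ext (Prod.ext ?_ hij)
    change e x.1.2 = s * b.1.1
    rw [← hs, hij, mul_assoc, b.2.2]

/-- The free pointed act on a pointed set `X`, whose nonzero elements are the pairs of a nonzero
scalar and an element of `X`. -/
def FreePAct (S X : Type u) [Zero S] [Zero X] : Type u :=
  {x : S × X // x.1 = 0 → x.2 = 0}

namespace FreePAct

variable {S X : Type u} [MonoidWithZero S] [Zero X]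

instance : Zero (FreePAct S X) := ⟨⟨(0, 0), fun _ => rfl⟩⟩

open Classical in
/-- The pair `(s, x)`, collapsed to zero when `s = 0`. -/
noncomputable def mk (s : S) (x : X) : FreePAct S X :=
  ⟨(s, if s = 0 then 0 else x), fun h => if_pos h⟩

theorem mk_zero (x : X) : mk (0 : S) x = 0 :=
  Subtype.ext (Prod.ext rfl (if_pos rfl))

theorem mk_self (x : FreePAct S X) : mk x.1.1 x.1.2 = x := by
  refine Subtype.ext (Prod.ext rfl ?_)
  by_cases h : x.1.1 = 0
  · exact (if_pos h).trans (x.2 h).symm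
  · exact if_neg h

theorem mk_mul_snd (s t : S) (x : X) : mk (s * t) (mk t x).1.2 = mk (s * t) x := by
  refine Subtype.ext (Prod.ext rfl ?_)
  by_cases h : t = 0 <;> simp [mk, h]

noncomputable instance : MulActionWithZero S (FreePAct S X) where
  smul s x := mk (s * x.1.1) x.1.2
  one_smul x := by
    change mk (1 * x.1.1) x.1.2 = x
    rw [one_mul, mk_self]
  mul_smul s t x := by
    change mk (s * t * x.1.1) x.1.2 = mk (s * (t * x.1.1)) (mk (t * x.1.1) x.1.2).1.2
    rw [mk_mul_snd, mul_assoc]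
  smul_zero s := by
    change mk (s * 0) 0 = (0 : FreePAct S X)
    rw [mul_zero, mk_zero]
  zero_smul x := by
    change mk (0 * x.1.1) x.1.2 = (0 : FreePAct S X)
    rw [zero_mul, mk_zero]

theorem smul_def (s : S) (x : FreePAct S X) : s • x = mk (s * x.1.1) x.1.2 := rfl

end FreePAct

/-- Nonzero elements of a projective pointed act have coordinates: `p = τ p • ι p`, with `τ`
equivariant and `ι` invariant on nonzero multiples. -/
theorem PActProjective.exists_coordinates {S : Type u} [MonoidWithZero S] {P : Type u} [Zero P]
    [MulActionWithZero S P] (hP : PActProjective S P) :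
    ∃ (τ : P → S) (ι : P → P), (∀ p, τ p • ι p = p) ∧
      ∀ (s : S) (p : P), s • p ≠ 0 → τ (s • p) = s * τ p ∧ ι (s • p) = ι p := by
  have hmk (s : S) (x : P) : (FreePAct.mk s x).1.1 • (FreePAct.mk s x).1.2 = s • x := by
    by_cases h : s = 0 <;> simp [FreePAct.mk, h]
  obtain ⟨h, hs, -, hh⟩ := hP (FreePAct S P) P (fun x => x.1.1 • x.1.2) id
    (fun p => ⟨FreePAct.mk 1 p, (hmk 1 p).trans (one_smul _ _)⟩)
    (fun s x => (hmk _ _).trans (mul_smul _ _ _)) (smul_zero _) (fun _ _ => rfl) rfl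
  refine ⟨fun p => (h p).1.1, fun p => (h p).1.2, fun p => congrFun hh p, fun s p hsp => ?_⟩
  have hne : s * (h p).1.1 ≠ 0 := by
    intro h0
    apply hsp
    rw [← show (h p).1.1 • (h p).1.2 = p from congrFun hh p, ← mul_smul, h0, zero_smul]
  have hsmul := (hs s p).trans (FreePAct.smul_def s (h p))
  exact ⟨congrArg (fun x => x.1.1) hsmul, (congrArg (fun x => x.1.2) hsmul).trans (if_neg hne)⟩

theorem IsPProjCover.hasTightGenerators {S : Type u} [MonoidWithZero S] {P : Type u} [Zero P]
    [MulActionWithZero S P] {A : Type u} [Zero A] [MulActionWithZero S A] {f : P → A}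
    (hf : IsPProjCover S P A f) : HasTightGenerators S A := by
  obtain ⟨hsurj, hf0, hfs, hproj, hmin⟩ := hf
  by_cases hA : ∀ a : A, a = 0
  · exact ⟨Set.univ, fun _ => 0, fun a => ⟨a, trivial, 1, one_smul _ _⟩,
      fun i _ j _ _ _ => (hA i).trans (hA j).symm,
      fun i _ => ⟨mul_zero _, (hA _).trans (hA i).symm, fun _ _ => ⟨0, mul_zero _⟩⟩⟩
  obtain ⟨τ, ι, hτι, hmul⟩ := hproj.exists_coordinates
  have coord {p : P} (hp : p ≠ 0) : ι p ≠ 0 ∧ ι (ι p) = ι p := by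
    refine ⟨fun h => hp (by rw [← hτι p, h, smul_zero]), ?_⟩
    have := (hmul (τ p) (ι p) (by rwa [hτι])).2
    rwa [hτι, eq_comm] at this
  have key {i x : P} (hi : i ≠ 0) (hii : ι i = i) (hx : f x = f i) : ∃ s : S, s • x = i := by
    by_contra hcon
    refine hmin {p | p = 0 ∨ ι p ≠ i ∨ ∃ s : S, s • x = p} ⟨Or.inl rfl, ?_⟩ ?_ ?_
    · rintro s p (rfl | hp | ⟨r, rfl⟩)
      · exact Or.inl (smul_zero _)
      · by_cases h : s • p = 0
        · exact Or.inl h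
        · exact Or.inr (Or.inl ((hmul s p h).2 ▸ hp))
      · exact Or.inr (Or.inr ⟨s * r, mul_smul _ _ _⟩)
    · intro huniv
      rcases huniv ▸ Set.mem_univ i with h | h | h
      exacts [hi h, h hii, hcon h]
    · refine Set.eq_univ_of_forall fun a => ?_
      obtain ⟨p, rfl⟩ := hsurj a
      by_cases hp : ι p = i
      · exact ⟨τ p • x, Or.inr (Or.inr ⟨_, rfl⟩), by rw [hfs, hx, ← hfs, ← hp, hτι]⟩
      · exact ⟨p, Or.inr (Or.inl hp), rfl⟩
  have lift (a : A) : ∃ i, a ∈ f '' {i | i ≠ 0 ∧ ι i = i} → (i ≠ 0 ∧ ι i = i) ∧ f i = a := by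
    by_cases h : a ∈ f '' {i | i ≠ 0 ∧ ι i = i}
    · obtain ⟨i, hi, hia⟩ := h
      exact ⟨i, fun _ => ⟨hi, hia⟩⟩
    · exact ⟨0, fun h' => absurd h' h⟩
  choose g hg using lift
  refine ⟨f '' {i | i ≠ 0 ∧ ι i = i}, fun a => τ (g a), ?_, ?_, ?_⟩
  · have hnz {p : P} (hp : p ≠ 0) : ∃ i ∈ f '' {i | i ≠ 0 ∧ ι i = i}, ∃ s : S, s • i = f p :=
      ⟨f (ι p), ⟨_, coord hp, rfl⟩, τ p, by rw [← hfs, hτι]⟩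
    intro a
    obtain ⟨p, rfl⟩ := hsurj a
    by_cases hp : p = 0
    · obtain ⟨b, hb⟩ := not_forall.mp hA
      obtain ⟨q, rfl⟩ := hsurj b
      obtain ⟨i, hi, -⟩ := hnz (p := q) (fun h => hb (h ▸ hf0))
      exact ⟨i, hi, 0, by rw [zero_smul, hp, hf0]⟩
    · exact hnz hp
  · rintro _ ⟨i, ⟨hi, hii⟩, rfl⟩ _ ⟨j, ⟨hj, hjj⟩, rfl⟩ s hs
    obtain ⟨r, hr⟩ := key (x := s • j) hi hii (by rw [hfs, hs])
    rw [← mul_smul] at hr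
    have := (hmul (r * s) j (hr ▸ hi)).2
    rw [hr, hii, hjj] at this
    rw [this]
  · intro a ha
    obtain ⟨⟨hi, hii⟩, hia⟩ := hg a ha
    have hfix : τ (g a) • g a = g a := by
      conv_rhs => rw [← hτι (g a), hii]
    refine ⟨?_, ?_, fun t ht => ?_⟩
    · have := (hmul (τ (g a)) (g a) (by rwa [hfix])).1
      rwa [hfix, eq_comm] at this
    · have := hfs (τ (g a)) (g a)
      rwa [hfix, hia, eq_comm] at this
    · obtain ⟨s, hs⟩ := key (x := t • g a) hi hii (by rw [hfs, hia, ht])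
      rw [← mul_smul] at hs
      have := (hmul (s * t) (g a) (by rwa [hs])).1
      rw [hs] at this
      exact ⟨s, this.symm⟩

/-- The elements of an act whose zero multiple is `z`. -/
def ZeroFiber (S : Type u) [MonoidWithZero S] {A : Type u} [MulAction S A] (z : A) : Type u :=
  {a : A // (0 : S) • a = z}

/-- The fiber over a fixed point is a pointed act. -/
abbrev ZeroFiber.zero {S : Type u} [MonoidWithZero S] {A : Type u} [MulAction S A] {z : A}
    (hz : (0 : S) • z = z) : Zero (ZeroFiber S z) := ⟨⟨z, hz⟩⟩

/-- The pointed action on the fiber over a fixed point. -/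
abbrev ZeroFiber.mulActionWithZero {S : Type u} [MonoidWithZero S] {A : Type u} [MulAction S A]
    {z : A} (hz : (0 : S) • z = z) :
    letI := ZeroFiber.zero hz
    MulActionWithZero S (ZeroFiber S z) :=
  letI := ZeroFiber.zero hz
  { smul := fun s a => ⟨s • a.1, by rw [← mul_smul, zero_mul, a.2]⟩
    one_smul := fun a => Subtype.ext (one_smul _ _)
    mul_smul := fun s t a => Subtype.ext (mul_smul _ _ _)
    smul_zero := fun s => Subtype.ext (by
      change s • z = z
      rw [← hz, ← mul_smul, mul_zero])
    zero_smul := fun a => Subtype.ext a.2 }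

theorem Left0Perfect.hasTightGenerators {S : Type u} [MonoidWithZero S] (hS : Left0Perfect S)
    (A : Type u) [MulAction S A] : HasTightGenerators S A := by
  have zero_smul_smul (s : S) (a : A) : (0 : S) • s • a = (0 : S) • a := by
    rw [← mul_smul, zero_mul]
  have fiber (a : A) : ∃ (I : Set A) (e : A → S),
      (∀ b, (0 : S) • b = (0 : S) • a → ∃ i ∈ I, (0 : S) • i = (0 : S) • a ∧ ∃ s : S, s • i = b) ∧
      (∀ i ∈ I, ∀ j ∈ I, ∀ s : S, s • j = i → i = j) ∧
      ∀ i ∈ I, e i * e i = e i ∧ e i • i = i ∧ ∀ t : S, t • i = i → ∃ s, s * t * e i = e i := by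
    classical
    have hz : (0 : S) • (0 : S) • a = (0 : S) • a := zero_smul_smul _ _
    let _ := ZeroFiber.zero hz
    let _ := ZeroFiber.mulActionWithZero hz
    obtain ⟨P, _, _, f, hf⟩ := hS (ZeroFiber S ((0 : S) • a)) inferInstance inferInstance
    obtain ⟨I, e, hgen, hirr, he⟩ := hf.hasTightGenerators
    refine ⟨Subtype.val '' I, fun b => if h : (0 : S) • b = (0 : S) • a then e ⟨b, h⟩ else 0,
      ?_, ?_, ?_⟩
    · intro b hb
      obtain ⟨i, hi, s, hs⟩ := hgen ⟨b, hb⟩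
      exact ⟨i.1, ⟨i, hi, rfl⟩, i.2, s, congrArg Subtype.val hs⟩
    · rintro _ ⟨i, hi, rfl⟩ _ ⟨j, hj, rfl⟩ s hs
      exact congrArg Subtype.val (hirr i hi j hj s (Subtype.ext hs))
    · rintro _ ⟨i, hi, rfl⟩
      obtain ⟨h₁, h₂, h₃⟩ := he i hi
      have hei : (if h : (0 : S) • i.1 = (0 : S) • a then e ⟨i.1, h⟩ else 0) = e i := dif_pos i.2
      beta_reduce
      rw [hei]
      exact ⟨h₁, congrArg Subtype.val h₂, fun t ht => h₃ t (Subtype.ext ht)⟩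
  have fiber' (z : A) : ∃ (I : Set A) (e : A → S), (0 : S) • z = z →
      (∀ b, (0 : S) • b = z → ∃ i ∈ I, (0 : S) • i = z ∧ ∃ s : S, s • i = b) ∧
      (∀ i ∈ I, ∀ j ∈ I, ∀ s : S, s • j = i → i = j) ∧
      ∀ i ∈ I, e i * e i = e i ∧ e i • i = i ∧ ∀ t : S, t • i = i → ∃ s, s * t * e i = e i := by
    obtain ⟨I, e, h⟩ := fiber z
    exact ⟨I, e, fun hz => by rwa [hz] at h⟩
  choose I e h using fiber'
  refine ⟨{a | a ∈ I ((0 : S) • a)}, fun a => e ((0 : S) • a) a, fun a => ?_,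
    fun i hi j hj s hs => ?_, fun i hi => (h _ (zero_smul_smul _ _)).2.2 i hi⟩
  · obtain ⟨i, hi, hia, s, hs⟩ := (h _ (zero_smul_smul 0 a)).1 a rfl
    exact ⟨i, by rwa [Set.mem_ofPred_eq, hia], s, hs⟩
  · have hij : (0 : S) • j = (0 : S) • i := by rw [← hs, zero_smul_smul]
    exact (h _ (zero_smul_smul 0 i)).2.1 i hi j (hij ▸ hj) s hs

/-- The equivalence relation gluing all fixed points of an act together. -/
def zeroSetoid (S : Type u) [MonoidWithZero S] (P : Type u) [MulAction S P] : Setoid P where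
  r x y := x = y ∨ (0 : S) • x = x ∧ (0 : S) • y = y
  iseqv :=
    { refl := fun _ => Or.inl rfl
      symm := fun h => h.imp Eq.symm And.symm
      trans := by
        rintro x y z (rfl | h) (rfl | h')
        exacts [Or.inl rfl, Or.inr h', Or.inr h, Or.inr ⟨h.1, h'.2⟩] }

/-- The quotient of an act by `zeroSetoid`, pointed by the class of the zero multiple of `p`. -/
abbrev zeroQuotientZero (S : Type u) [MonoidWithZero S] {P : Type u} [MulAction S P] (p : P) :
    Zero (Quotient (zeroSetoid S P)) := ⟨Quotient.mk _ ((0 : S) • p)⟩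

/-- The pointed action on the quotient of an act by `zeroSetoid`. -/
abbrev zeroQuotientAction (S : Type u) [MonoidWithZero S] {P : Type u} [MulAction S P] (p : P) :
    letI := zeroQuotientZero S p
    MulActionWithZero S (Quotient (zeroSetoid S P)) :=
  letI := zeroQuotientZero S p
  { smul := fun s => Quotient.map (s • ·) (by
      rintro x y (rfl | ⟨hx, hy⟩)
      · exact Or.inl rfl
      · refine Or.inr ⟨?_, ?_⟩
        · rw [← hx, ← mul_smul s, mul_zero, hx, hx]
        · rw [← hy, ← mul_smul s, mul_zero, hy, hy])
    one_smul := by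
      rintro ⟨x⟩
      exact congrArg (Quotient.mk _) (one_smul S x)
    mul_smul := by
      rintro s t ⟨x⟩
      exact congrArg (Quotient.mk _) (mul_smul s t x)
    smul_zero := fun s => congrArg (Quotient.mk _) (show s • (0 : S) • p = (0 : S) • p by
      rw [← mul_smul, mul_zero])
    zero_smul := by
      rintro ⟨x⟩
      refine Quotient.sound (Or.inr ⟨?_, ?_⟩) <;> rw [← mul_smul, zero_mul] }

theorem IsProjCover.exists_isPProjCover {S : Type u} [MonoidWithZero S] {P : Type u}
    [MulAction S P] {A : Type u} [Zero A] [MulActionWithZero S A] {f : P → A}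
    (hf : IsProjCover S P A f) :
    ∃ (Q : Type u) (_ : Zero Q) (_ : MulActionWithZero S Q) (g : Q → A),
      IsPProjCover S Q A g := by
  obtain ⟨hsurj, hfs, hproj, hmin⟩ := hf
  obtain ⟨p, -⟩ := hsurj 0
  let _ := zeroQuotientZero S p
  let _ := zeroQuotientAction S p
  have lifts {B : Type u} [Zero B] [MulActionWithZero S B] {h : P → B}
      (hs : ∀ (s : S) (x : P), h (s • x) = s • h x) (x y : P)
      (hxy : (zeroSetoid S P).r x y) : h x = h y := by
    rcases hxy with rfl | ⟨hx, hy⟩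
    · rfl
    · rw [← hx, ← hy, hs, hs, zero_smul, zero_smul]
  refine ⟨Quotient (zeroSetoid S P), inferInstance, inferInstance, Quotient.lift f (lifts hfs),
    ?_, ?_, ?_, ?_, ?_⟩
  · intro a
    obtain ⟨x, rfl⟩ := hsurj a
    exact ⟨Quotient.mk _ x, rfl⟩
  · exact (hfs 0 p).trans (zero_smul _ _)
  · rintro s ⟨x⟩
    exact hfs s x
  · intro B C _ _ _ _ π g hπ hπs hπ0 hgs hg0
    obtain ⟨h, hs, hh⟩ := hproj B C π (fun x => g (Quotient.mk _ x)) hπ hπs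
      (fun s x => hgs s (Quotient.mk _ x))
    refine ⟨Quotient.lift h (lifts hs), ?_, (hs 0 p).trans (zero_smul _ _), ?_⟩
    · rintro s ⟨x⟩
      exact hs s x
    · funext q
      induction q using Quotient.inductionOn with
      | h x => exact congrFun hh x
  · intro B hB hne himg
    refine hmin (Quotient.mk _ ⁻¹' B) ⟨⟨(0 : S) • p, hB.1⟩, fun s x hx => hB.2 s hx⟩ ?_ ?_
    · intro huniv
      refine hne (Set.eq_univ_of_forall fun q => ?_)
      induction q using Quotient.inductionOn with
      | h x => exact (huniv ▸ Set.mem_univ x : x ∈ Quotient.mk _ ⁻¹' B)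
    · refine Set.eq_univ_of_forall fun a => ?_
      obtain ⟨q, hq, rfl⟩ : a ∈ Quotient.lift f (lifts hfs) '' B := himg ▸ Set.mem_univ a
      induction q using Quotient.inductionOn with
      | h x => exact ⟨x, hq, rfl⟩

/-- a monoid `S` with zero (`0 ≠ 1`) is left perfect if and
only if it is left 0-perfect. -/
theorem stmt_12 {S : Type u} [MonoidWithZero S] (h01 : (0 : S) ≠ 1) :
    LeftPerfect S ↔ Left0Perfect S := by
  constructor
  · intro hS A _ _
    obtain ⟨P, _, f, hf⟩ := hS A inferInstance ⟨0⟩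
    exact hf.exists_isPProjCover
  · intro hS A _ _
    exact (hS.hasTightGenerators A).exists_isProjCover
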